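/- Let p, n ≥ 1, let S = (S_0, …, S_{2n}) be a truncated matrix moment sequence whose moment matrix M(n) is positive definite, let t ∈ ℝ and m ∈ ℕ ∪ {0}, and suppose m ≤ rank H_{x−t}(n−1) − (n−1)p, where H_{x−t}(n−1) = (S_{i+j−1} − t·S_{i+j−2})_{i,j=1}^{n}. Then there exists a real symmetric p×p matrix S_{2n+1} such that the extended (x−t)-localizing matrix H_{x−t}(n) := (S_{i+j−1} − t·S_{i+j−2})_{i,j=1}^{n+1}, of size (n+1)p, has rank exactly (n+1)p − m (equivalently, its kernel has dimension exactly m). -/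

import Mathlib

open Matrix

/-- The `n`-th truncated moment matrix. -/
def momentMatrix (p n : ℕ) (S : ℕ → Matrix (Fin p) (Fin p) ℝ) :
    Matrix (Fin (n + 1) × Fin p) (Fin (n + 1) × Fin p) ℝ :=
  fun i j => S (i.1.1 + j.1.1) i.2 j.2

/-- The `(x - t)`-localizing moment matrix of size `kp`: the `(i,j)`-th `p × p` block is
`S (i + j + 1) - t • S (i + j)` for `0 ≤ i, j ≤ k - 1`. -/
def locMatrix (p k : ℕ) (t : ℝ) (S : ℕ → Matrix (Fin p) (Fin p) ℝ) :
    Matrix (Fin k × Fin p) (Fin k × Fin p) ℝ :=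
  fun i j => S (i.1.1 + j.1.1 + 1) i.2 j.2 - t * S (i.1.1 + j.1.1) i.2 j.2

lemma exists_sym_ginv {N : Type*} [Fintype N] [DecidableEq N] (A : Matrix N N ℝ)
    (hA : A.IsSymm) : ∃ G : Matrix N N ℝ, G.IsSymm ∧ A * G * A = A := by
  obtain ⟨r, hr⟩ := A.mulVecLin.rangeRestrict.exists_rightInverse_of_surjective
    (LinearMap.range_rangeRestrict _)
  obtain ⟨g, hg⟩ := LinearMap.exists_extend r
  set g' := LinearMap.toMatrix' g with hg'
  have key : A * g' * A = A := by
    apply Matrix.toLin'.injective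
    ext1 i
    ext1
    have h1 : g (A.mulVecLin (Pi.single i 1)) = r (A.mulVecLin.rangeRestrict (Pi.single i 1)) := by
      rw [← hg]; rfl
    have h2 := congrArg Subtype.val
      (LinearMap.congr_fun hr (A.mulVecLin.rangeRestrict (Pi.single i 1)))
    simp only [LinearMap.comp_apply, LinearMap.id_apply, LinearMap.codRestrict_apply,
      LinearMap.rangeRestrict] at h1 h2
    simp only [Matrix.toLin'_mul, LinearMap.comp_apply, hg', Matrix.toLin'_toMatrix',
      LinearMap.single_apply]
    have e : Matrix.toLin' A = A.mulVecLin := rfl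
    rw [e, h1]
    simpa using h2
  have key2 : A * g'ᵀ * A = A := by
    have := congrArg Matrix.transpose key
    rw [Matrix.transpose_mul, Matrix.transpose_mul, hA.eq, ← Matrix.mul_assoc] at this
    exact this
  refine ⟨(1/2 : ℝ) • (g' + g'ᵀ), ?_, ?_⟩
  · simp [Matrix.IsSymm, add_comm]
  · rw [Matrix.mul_smul, Matrix.smul_mul, Matrix.mul_add, Matrix.add_mul, key, key2, ← two_smul ℝ A,
      smul_smul]
    norm_num

lemma exists_ker_matrix {P : Type*} [Fintype P] [DecidableEq P] (K : Submodule ℝ (P → ℝ)) :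
    ∃ L : Matrix P P ℝ, ∀ v, L *ᵥ v = 0 ↔ v ∈ K := by
  obtain ⟨C, hC⟩ := K.exists_isCompl
  refine ⟨LinearMap.toMatrix' (C.subtype ∘ₗ Submodule.projectionOnto C K hC.symm), fun v => ?_⟩
  rw [← Matrix.toLin'_apply, Matrix.toLin'_toMatrix']
  rw [LinearMap.comp_apply, Submodule.subtype_apply, Submodule.coe_eq_zero,
    Submodule.projectionOnto_apply_eq_zero_iff]

lemma exists_sub_finrank {V : Type*} [AddCommGroup V] [Module ℝ V] {m : ℕ}
    (h : m ≤ Module.finrank ℝ V) : ∃ K : Submodule ℝ V, Module.finrank ℝ K = m := by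
  obtain ⟨f, hf⟩ := exists_linearIndependent_of_le_finrank h
  exact ⟨Submodule.span ℝ (Set.range f), by simpa using finrank_span_eq_card hf⟩

lemma block_ext {N P : Type*} [Fintype N] [DecidableEq N] [Fintype P] [DecidableEq P]
    (A : Matrix N N ℝ) (hA : A.IsSymm) (B : Matrix N P ℝ)
    (hinj : ∀ w, A *ᵥ w = 0 → Bᵀ *ᵥ w = 0 → w = 0) (m : ℕ)
    (hm : m + Fintype.card N ≤ A.rank + Fintype.card P) :
    ∃ D : Matrix P P ℝ, D.IsSymm ∧
      (fromBlocks A B Bᵀ D).rank + m = Fintype.card N + Fintype.card P := by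
  obtain ⟨G, hG, hAGA⟩ := exists_sym_ginv A hA
  set V : Submodule ℝ (P → ℝ) := (LinearMap.range A.mulVecLin).comap B.mulVecLin with hV
  have hdV : m ≤ Module.finrank ℝ V := by
    have hk : V = LinearMap.ker ((LinearMap.range A.mulVecLin).mkQ ∘ₗ B.mulVecLin) := by
      rw [LinearMap.ker_comp, Submodule.ker_mkQ]
    have h1 := LinearMap.finrank_range_add_finrank_ker
      ((LinearMap.range A.mulVecLin).mkQ ∘ₗ B.mulVecLin)
    have h2 := Submodule.finrank_le (LinearMap.range
      ((LinearMap.range A.mulVecLin).mkQ ∘ₗ B.mulVecLin))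
    have h3 := Submodule.finrank_quotient_add_finrank (LinearMap.range A.mulVecLin)
    rw [← hk] at h1
    simp only [Module.finrank_fintype_fun_eq_card] at h1 h3
    unfold Matrix.rank at hm
    omega
  obtain ⟨K', hK'⟩ : ∃ K' : Submodule ℝ V, Module.finrank ℝ K' = m :=
    exists_sub_finrank hdV
  set K := K'.map V.subtype with hK
  have hKV : K ≤ V := Submodule.map_subtype_le _ _
  have hKm : Module.finrank ℝ K = m := by
    rw [hK, ← (Submodule.equivMapOfInjective _ V.injective_subtype K').finrank_eq, hK']
  obtain ⟨L, hL⟩ := exists_ker_matrix K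
  refine ⟨Bᵀ * G * B + Lᵀ * L, ?_, ?_⟩
  · simp [Matrix.IsSymm, Matrix.transpose_add, Matrix.transpose_mul, hG.eq, Matrix.mul_assoc]
  set H := fromBlocks A B Bᵀ (Bᵀ * G * B + Lᵀ * L) with hH
  have hAG : ∀ v ∈ V, A *ᵥ (G *ᵥ (B *ᵥ v)) = B *ᵥ v := by
    rintro v ⟨u, hu⟩
    simp only [Matrix.mulVecLin_apply] at hu
    rw [← hu, Matrix.mulVec_mulVec, Matrix.mulVec_mulVec, hAGA]
  -- the kernel is the graph over K
  let f : (P → ℝ) →ₗ[ℝ] (N ⊕ P → ℝ) :=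
    { toFun := fun v => Sum.elim (-(G *ᵥ (B *ᵥ v))) v
      map_add' := by
        intro x y; ext i; rcases i with i | i <;> simp [Matrix.mulVec_add, add_comm]
      map_smul' := by
        intro c x; ext i; rcases i with i | i <;> simp [Matrix.mulVec_smul] }
  have hf : Function.Injective f := by
    intro x y hxy
    ext i
    exact congrFun hxy (Sum.inr i)
  have hker : LinearMap.ker H.mulVecLin = K.map f := by
    ext z
    rw [LinearMap.mem_ker, Matrix.mulVecLin_apply, Submodule.mem_map]
    constructor
    · intro hz
      set u := z ∘ Sum.inl with hu
      set v := z ∘ Sum.inr with hv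
      rw [hH, Matrix.fromBlocks_mulVec] at hz
      have e1 : A *ᵥ u + B *ᵥ v = 0 := by
        ext i; exact congrFun hz (Sum.inl i)
      have e2 : Bᵀ *ᵥ u + (Bᵀ * G * B + Lᵀ * L) *ᵥ v = 0 := by
        ext i; exact congrFun hz (Sum.inr i)
      have hBv : B *ᵥ v = A *ᵥ (-u) := by
        rw [Matrix.mulVec_neg]; exact (neg_eq_of_add_eq_zero_right e1).symm
      have hvV : v ∈ V := ⟨-u, hBv.symm⟩
      set w := u + G *ᵥ (B *ᵥ v) with hw
      have hAw : A *ᵥ w = 0 := by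
        rw [hw, Matrix.mulVec_add, hAG v hvV, e1]
      have e3 : Bᵀ *ᵥ w + Lᵀ *ᵥ (L *ᵥ v) = 0 := by
        rw [← e2, hw, Matrix.mulVec_add, Matrix.add_mulVec, Matrix.mulVec_mulVec,
          Matrix.mulVec_mulVec, Matrix.mulVec_mulVec, add_assoc]
      have horth : v ⬝ᵥ (Bᵀ *ᵥ w) = 0 := by
        rw [Matrix.dotProduct_mulVec, Matrix.vecMul_transpose, hBv, ← Matrix.vecMul_transpose,
          hA.eq, ← Matrix.dotProduct_mulVec, hAw, dotProduct_zero]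
      have hLL : (L *ᵥ v) ⬝ᵥ (L *ᵥ v) = 0 := by
        have := congrArg (fun x => v ⬝ᵥ x) e3
        simp only [dotProduct_add, horth, zero_add, dotProduct_zero] at this
        rwa [Matrix.dotProduct_mulVec, Matrix.vecMul_transpose] at this
      have hLv : L *ᵥ v = 0 := dotProduct_self_eq_zero.mp hLL
      have hw0 : w = 0 := by
        apply hinj w hAw
        simpa [hLv] using e3
      refine ⟨v, (hL v).mp hLv, ?_⟩
      ext i
      rcases i with i | i
      · have := congrFun hw0 i
        simp only [hw, Pi.add_apply, Pi.zero_apply] at this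
        change -((G *ᵥ (B *ᵥ v)) i) = u i
        linarith
      · rfl
    · rintro ⟨v, hvK, rfl⟩
      have hLv := (hL v).mpr hvK
      have hvV := hKV hvK
      change H *ᵥ (Sum.elim (-(G *ᵥ (B *ᵥ v))) v) = 0
      rw [hH, Matrix.fromBlocks_mulVec]
      simp only [Sum.elim_comp_inl, Sum.elim_comp_inr]
      rw [Matrix.mulVec_neg, hAG v hvV, Matrix.mulVec_neg, Matrix.add_mulVec,
        ← Matrix.mulVec_mulVec v Lᵀ L, hLv, Matrix.mul_assoc, ← Matrix.mulVec_mulVec,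
        ← Matrix.mulVec_mulVec]
      ext i
      rcases i with i | i <;> simp
  have h1 := LinearMap.finrank_range_add_finrank_ker H.mulVecLin
  rw [hker, ← (Submodule.equivMapOfInjective f hf K).finrank_eq, hKm] at h1
  simpa [Matrix.rank] using h1

lemma loc_inj (p n : ℕ) (S : ℕ → Matrix (Fin p) (Fin p) ℝ)
    (hM : (momentMatrix p n S).PosDef) (t : ℝ) (w : Fin n × Fin p → ℝ)
    (h : ∀ (i : Fin (n + 1)) (a : Fin p), ∑ j : Fin n, ∑ b : Fin p,
      (S (i.1 + j.1 + 1) a b - t * S (i.1 + j.1) a b) * w (j, b) = 0) : w = 0 := by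
  let x : Fin (n + 1) → Fin p → ℝ := Fin.cons 0 (fun j b => w (j, b))
  let y : Fin (n + 1) → Fin p → ℝ := Fin.snoc (fun j b => w (j, b)) 0
  let z : Fin (n + 1) × Fin p → ℝ := fun q => x q.1 q.2 - t * y q.1 q.2
  have hz : momentMatrix p n S *ᵥ z = 0 := by
    ext ⟨i, a⟩
    have h' := h i a
    simp only [Matrix.mulVec, dotProduct, momentMatrix, Fintype.sum_prod_type, z, mul_sub,
      Finset.sum_sub_distrib, Pi.zero_apply]
    rw [Fin.sum_univ_succ, Fin.sum_univ_castSucc (f := fun j => ∑ b, _ * (t * y j b))]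
    simp only [x, y, Fin.cons_zero, Fin.cons_succ, Fin.snoc_castSucc, Fin.snoc_last, Pi.zero_apply,
      mul_zero, Finset.sum_const_zero, zero_add, add_zero, Fin.val_succ, Fin.val_castSucc]
    rw [← h', ← Finset.sum_sub_distrib]
    refine Finset.sum_congr rfl fun j _ => ?_
    rw [← Finset.sum_sub_distrib]
    refine Finset.sum_congr rfl fun b _ => ?_
    rw [← add_assoc]
    ring
  have hz0 : z = 0 := by
    apply Matrix.mulVec_injective_of_isUnit hM.isUnit
    rw [hz, Matrix.mulVec_zero]
  have hy : ∀ j : Fin (n + 1), y j = 0 := by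
    intro j
    induction j using Fin.reverseInduction with
    | last => simp [y]
    | cast j ih =>
      ext b
      have h1 : z (j.succ, b) = 0 := by rw [hz0]; rfl
      simp only [z, ih, x, Fin.cons_succ, Pi.zero_apply, mul_zero, sub_zero] at h1
      simpa [y] using h1
  ext ⟨j, b⟩
  have := congrFun (hy j.castSucc) b
  simpa [y] using this


/-- Key step in the proof of Theorem 1.1: if `M(n) ≻ 0` and
`m ≤ rank H_{x-t}(n-1) - (n-1)p`, then one can choose a symmetric `S_{2n+1}` so that the
extended localizing matrix `H_{x-t}(n)` of size `(n+1)p` has rank exactly `(n+1)p - m`. -/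
theorem exists_extension_with_kernel_dim (p n : ℕ) (hp : 1 ≤ p) (hn : 1 ≤ n)
    (S : ℕ → Matrix (Fin p) (Fin p) ℝ)
    (hSsym : ∀ i ≤ 2 * n, (S i).IsSymm)
    (hM : (momentMatrix p n S).PosDef)
    (t : ℝ) (m : ℕ)
    (hm : m + (n - 1) * p ≤ (locMatrix p n t S).rank) :
    ∃ Z : Matrix (Fin p) (Fin p) ℝ, Z.IsSymm ∧
      (locMatrix p (n + 1) t (fun k => if k = 2 * n + 1 then Z else S k)).rank + m =
        (n + 1) * p := by
  let A := locMatrix p n t S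
  let B : Matrix (Fin n × Fin p) (Fin p) ℝ :=
    fun i b => S (i.1.1 + n + 1) i.2 b - t * S (i.1.1 + n) i.2 b
  have hs : ∀ i ≤ 2 * n, ∀ a b, S i a b = S i b a := fun i hi a b => (hSsym i hi).apply b a
  have hA : A.IsSymm := by
    ext ⟨i, a⟩ ⟨j, b⟩
    simp only [A, Matrix.transpose_apply, locMatrix]
    rw [hs (j.1 + i.1 + 1) (by omega), hs (j.1 + i.1) (by omega), add_comm j.1 i.1]
  have hinj : ∀ w, A *ᵥ w = 0 → Bᵀ *ᵥ w = 0 → w = 0 := by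
    intro w h1 h2
    apply loc_inj p n S hM t w
    intro i a
    induction i using Fin.lastCases with
    | last =>
      have := congrFun h2 a
      simp only [Matrix.mulVec, dotProduct, Fintype.sum_prod_type, Matrix.transpose_apply,
        Pi.zero_apply] at this
      rw [← this]
      refine Finset.sum_congr rfl fun j _ => Finset.sum_congr rfl fun b _ => ?_
      rw [Fin.val_last, hs (n + j.1 + 1) (by omega), hs (n + j.1) (by omega), add_comm n j.1]
    | cast i =>
      have := congrFun h1 (i, a)
      simp only [Matrix.mulVec, dotProduct, Fintype.sum_prod_type, A, locMatrix,
        Pi.zero_apply] at this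
      exact this
  obtain ⟨D, hD, hr⟩ := block_ext A hA B hinj m (by
    obtain ⟨k, rfl⟩ : ∃ k, n = k + 1 := ⟨n - 1, by omega⟩
    simp only [Fintype.card_prod, Fintype.card_fin, A]
    simp only [Nat.add_sub_cancel] at hm
    rw [Nat.add_mul]
    omega)
  refine ⟨D + t • S (2 * n), ?_, ?_⟩
  · unfold Matrix.IsSymm
    rw [Matrix.transpose_add, Matrix.transpose_smul, hD.eq, (hSsym (2 * n) le_rfl).eq]
  let e : (Fin n × Fin p) ⊕ Fin p → Fin (n + 1) × Fin p :=
    Sum.elim (fun q => (q.1.castSucc, q.2)) (fun b => (Fin.last n, b))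
  have he : Function.Bijective e := by
    rw [Fintype.bijective_iff_surjective_and_card]
    constructor
    · rintro ⟨i, a⟩
      induction i using Fin.lastCases with
      | last => exact ⟨Sum.inr a, rfl⟩
      | cast i => exact ⟨Sum.inl (i, a), rfl⟩
    · simp [Nat.add_mul]
  set H := locMatrix p (n + 1) t (fun k => if k = 2 * n + 1 then D + t • S (2 * n) else S k) with hH
  have hsub : H.submatrix (Equiv.ofBijective e he) (Equiv.ofBijective e he)
      = fromBlocks A B Bᵀ D := by
    ext i j
    rcases i with ⟨i, a⟩ | a <;> rcases j with ⟨j, b⟩ | b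
    · have h1 : i.1 + j.1 + 1 ≠ 2 * n + 1 := by omega
      have h2 : i.1 + j.1 ≠ 2 * n + 1 := by omega
      simp [hH, locMatrix, e, A, h2, show i.1 + j.1 ≠ 2 * n by omega]
    · have h2 : i.1 + n ≠ 2 * n + 1 := by omega
      simp only [fromBlocks_apply₁₂]
      simp [hH, locMatrix, e, B, h2, show i.1 + n ≠ 2 * n by omega]
    · have h2 : n + j.1 ≠ 2 * n + 1 := by omega
      rw [fromBlocks_apply₂₁, Matrix.transpose_apply]
      simp only [hH, locMatrix, e, B, Matrix.submatrix_apply, Equiv.ofBijective_apply,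
        Sum.elim_inl, Sum.elim_inr, Fin.val_last, Fin.val_castSucc,
        if_neg h2, if_neg (show n + j.1 + 1 ≠ 2 * n + 1 by omega)]
      rw [hs (n + j.1 + 1) (by omega), hs (n + j.1) (by omega), add_comm n j.1]
    · have h2 : n + n = 2 * n := by omega
      simp [hH, locMatrix, e, h2]
  rw [← Matrix.rank_submatrix H (Equiv.ofBijective e he) (Equiv.ofBijective e he), hsub, hr]
  simp [Nat.add_mul]
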